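/- arXiv:1910.00126 — 3 statements merged into one kernel-verified Lean document; each statement's English description precedes it below -/
import Mathlib

section
/- The critical determinant of the open Euclidean unit disk in ℝ² equals √3/2, and it is attained by the hexagonal lattice generated by the columns of the matrix [[1/√Δ, 1/(2√Δ)], [0, √Δ]] with Δ = √3/2, scaled appropriately; in particular, every unimodular lattice in ℝ² contains a nonzero vector of Euclidean norm at most √(2/√3). -/
open MeasureTheory

/-- the points of the lattice spanned by the columns of `g` -/
def latticePts (g : Matrix (Fin 2) (Fin 2) ℝ) : Set (Fin 2 → ℝ) :=
  {v | ∃ m : Fin 2 → ℤ, v = g.mulVec fun i => (m i : ℝ)}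

/-- a lattice is `B`-admissible if it meets `B` only at `0` -/
def IsAdmissible (B : Set (Fin 2 → ℝ)) (g : Matrix (Fin 2) (Fin 2) ℝ) : Prop :=
  ∀ v ∈ latticePts g, v ∈ B → v = 0

/-- the critical determinant of `B` -/
noncomputable def criticalDet (B : Set (Fin 2 → ℝ)) : ℝ :=
  sInf {x : ℝ | ∃ g : Matrix (Fin 2) (Fin 2) ℝ,
    g.det ≠ 0 ∧ IsAdmissible B g ∧ x = |g.det|}

/-- the open Euclidean unit disk -/
def unitDisk : Set (Fin 2 → ℝ) := {v | (v 0) ^ 2 + (v 1) ^ 2 < 1}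

/-- Every point of the upper half plane admits an integral linear form `c z + d` that is small
relative to `z.im`. -/
lemma exists_normSq_denom_mul_sqrt_three_le (z : UpperHalfPlane) :
    ∃ c d : ℤ, (c ≠ 0 ∨ d ≠ 0) ∧
      ((c * z.re + d) ^ 2 + (c * z.im) ^ 2) * Real.sqrt 3 ≤ 2 * z.im := by
  obtain ⟨γ, hγ⟩ := ModularGroup.exists_smul_mem_fd z
  refine ⟨γ 1 0, γ 1 1, ?_, ?_⟩
  · by_contra! h
    have hdet := γ.det_coe
    rw [Matrix.det_fin_two, h.1, h.2] at hdet
    simp at hdet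
  · have him := ModularGroup.three_le_four_mul_im_sq_of_mem_fd hγ
    have hsqrt : Real.sqrt 3 ≤ 2 * (γ • z).im := by
      rw [Real.sqrt_le_left (by positivity [(γ • z).im_pos])]
      nlinarith
    have hnorm : Complex.normSq (UpperHalfPlane.denom γ z) =
        (γ 1 0 * z.re + γ 1 1) ^ 2 + (γ 1 0 * z.im) ^ 2 := by
      rw [ModularGroup.denom_apply, Complex.normSq_apply]
      simp
      ring
    have hpos : 0 < Complex.normSq (UpperHalfPlane.denom γ z) :=
      UpperHalfPlane.normSq_denom_pos _ z.im_ne_zero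
    rw [ModularGroup.im_smul_eq_div_normSq, mul_div_assoc', le_div_iff₀ hpos, hnorm] at hsqrt
    linarith

/-- The Hermite bound in dimension two: a lattice of covolume `δ` has a nonzero vector of squared
length at most `2 δ / √3`. -/
lemma exists_mem_latticePts_sq_mul_sqrt_three_le {g : Matrix (Fin 2) (Fin 2) ℝ}
    (hg : g.det ≠ 0) :
    ∃ v ∈ latticePts g, v ≠ 0 ∧ ((v 0) ^ 2 + (v 1) ^ 2) * Real.sqrt 3 ≤ 2 * |g.det| := by
  set N : ℝ := g 0 0 ^ 2 + g 1 0 ^ 2 with hN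
  set p : ℝ := g 0 0 * g 0 1 + g 1 0 * g 1 1 with hp
  have hdet : g.det = g 0 0 * g 1 1 - g 0 1 * g 1 0 := Matrix.det_fin_two g
  have hNpos : 0 < N := by
    rcases eq_or_ne (g 0 0) 0 with h | h
    · have h' : g 1 0 ≠ 0 := fun h' => hg (by rw [hdet, h, h']; ring)
      positivity
    · positivity
  obtain ⟨c, d, hcd, hle⟩ := exists_normSq_denom_mul_sqrt_three_le
    ⟨⟨p / N, |g.det| / N⟩, div_pos (abs_pos.mpr hg) hNpos⟩
  change ((c * (p / N) + d) ^ 2 + (c * (|g.det| / N)) ^ 2) * Real.sqrt 3 ≤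
    2 * (|g.det| / N) at hle
  refine ⟨g.mulVec fun i => ((![d, c] i : ℤ) : ℝ), ⟨_, rfl⟩, ?_, ?_⟩
  · intro h
    have hzero := Matrix.eq_zero_of_mulVec_eq_zero hg h
    have hd := congrFun hzero 0
    have hc := congrFun hzero 1
    simp at hc hd
    tauto
  · have hsq : ((c * (p / N) + d) ^ 2 + (c * (|g.det| / N)) ^ 2) * N =
        (g 0 0 * d + g 0 1 * c) ^ 2 + (g 1 0 * d + g 1 1 * c) ^ 2 := by
      rw [mul_pow _ (|g.det| / N), div_pow, sq_abs]
      have hlag : g.det ^ 2 = N * (g 0 1 ^ 2 + g 1 1 ^ 2) - p ^ 2 := by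
        rw [hdet, hN, hp]; ring
      rw [hlag]
      field_simp
      rw [hN, hp]
      ring
    have hmul := mul_le_mul_of_nonneg_right hle hNpos.le
    rw [mul_right_comm, hsq, mul_assoc 2, div_mul_cancel₀ _ hNpos.ne'] at hmul
    simpa [Matrix.mulVec, dotProduct, Fin.sum_univ_two] using hmul

lemma sqrt_three_div_two_le_abs_det {g : Matrix (Fin 2) (Fin 2) ℝ} (hg : g.det ≠ 0)
    (hadm : IsAdmissible unitDisk g) : Real.sqrt 3 / 2 ≤ |g.det| := by
  obtain ⟨v, hv, hv0, hle⟩ := exists_mem_latticePts_sq_mul_sqrt_three_le hg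
  have hone : 1 ≤ (v 0) ^ 2 + (v 1) ^ 2 := not_lt.mp fun h => hv0 (hadm v hv h)
  nlinarith [Real.sqrt_nonneg 3]

lemma sqrt_smul_hexagonal {Δ : ℝ} (hΔ : 0 < Δ) :
    Real.sqrt Δ • !![1 / Real.sqrt Δ, 1 / (2 * Real.sqrt Δ); 0, Real.sqrt Δ] =
      !![1, 1 / 2; 0, Δ] := by
  have hne : Real.sqrt Δ ≠ 0 := (Real.sqrt_pos.mpr hΔ).ne'
  ext i j
  fin_cases i <;> fin_cases j <;> simp [hne, hΔ.le]

lemma isAdmissible_hexagonal : IsAdmissible unitDisk !![1, 1 / 2; 0, Real.sqrt 3 / 2] := by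
  rintro v ⟨m, rfl⟩ hv
  have hform : ((m 0 ^ 2 + m 0 * m 1 + m 1 ^ 2 : ℤ) : ℝ) < 1 := by
    simp [unitDisk, dotProduct, Fin.sum_univ_two, mul_pow, div_pow] at hv
    push_cast
    linarith
  have hint : m 0 ^ 2 + m 0 * m 1 + m 1 ^ 2 < 1 := by exact_mod_cast hform
  have h1 : m 1 = 0 := by
    by_contra h
    have := Int.one_le_abs h
    nlinarith [sq_nonneg (2 * m 0 + m 1), sq_abs (m 1)]
  have h0 : m 0 = 0 := by
    rw [h1] at hint
    by_contra h
    have := Int.one_le_abs h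
    nlinarith [sq_abs (m 0)]
  ext i
  fin_cases i <;> simp [Matrix.mulVec, dotProduct, Fin.sum_univ_two, h0, h1]

lemma abs_det_hexagonal :
    |Matrix.det !![1, 1 / 2; 0, Real.sqrt 3 / 2]| = Real.sqrt 3 / 2 := by
  rw [Matrix.det_fin_two_of, mul_zero, sub_zero, one_mul, abs_of_pos (by positivity)]

/-- The critical determinant of the unit disk is `√3/2`; it is attained by a suitable
scaling of the hexagonal lattice generated by the columns of
`[[1/√Δ, 1/(2√Δ)], [0, √Δ]]`; and every unimodular lattice in `ℝ²` contains a
nonzero vector of Euclidean norm at most `√(2/√3)`. -/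
theorem criticalDet_unitDisk :
    criticalDet unitDisk = Real.sqrt 3 / 2 ∧
    (letI Δ : ℝ := Real.sqrt 3 / 2
     letI g₀ : Matrix (Fin 2) (Fin 2) ℝ :=
       !![1 / Real.sqrt Δ, 1 / (2 * Real.sqrt Δ); 0, Real.sqrt Δ]
     letI g : Matrix (Fin 2) (Fin 2) ℝ := Real.sqrt Δ • g₀
     IsAdmissible unitDisk g ∧ |Matrix.det g| = Real.sqrt 3 / 2) ∧
    (∀ g : Matrix (Fin 2) (Fin 2) ℝ, g.det = 1 →
      ∃ v ∈ latticePts g, v ≠ 0 ∧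
        Real.sqrt ((v 0) ^ 2 + (v 1) ^ 2) ≤ Real.sqrt (2 / Real.sqrt 3)) := by
  refine ⟨?_, ?_, ?_⟩
  · refine IsLeast.csInf_eq ⟨⟨_, ?_, isAdmissible_hexagonal, abs_det_hexagonal.symm⟩, ?_⟩
    · rw [← abs_pos, abs_det_hexagonal]
      positivity
    · rintro x ⟨g, hg, hadm, rfl⟩
      exact sqrt_three_div_two_le_abs_det hg hadm
  · rw [sqrt_smul_hexagonal (by positivity)]
    exact ⟨isAdmissible_hexagonal, abs_det_hexagonal⟩
  · intro g hg
    obtain ⟨v, hv, hv0, hle⟩ :=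
      exists_mem_latticePts_sq_mul_sqrt_three_le (g := g) (by rw [hg]; exact one_ne_zero)
    refine ⟨v, hv, hv0, Real.sqrt_le_sqrt ?_⟩
    rw [hg, abs_one, mul_one] at hle
    rwa [le_div_iff₀ (by positivity)]
end

section
/- Let Λ be a lattice in ℝ² intersecting a bounded open symmetric convex domain B trivially and having covolume equal to the critical determinant Δ_B. Then there exist points p, q, r of Λ on the boundary C of B with p = q − r such that any two of p, q, r form a basis of Λ. Conversely, if points p, q, r on C satisfy p = q − r, then the lattice generated by p and q is B-admissible. -/
/-- the lattice generated by the two vectors `u`, `v` -/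
def genLattice (u v : Fin 2 → ℝ) : Set (Fin 2 → ℝ) :=
  {w | ∃ a b : ℤ, w = (a : ℝ) • u + (b : ℝ) • v}

/-- The determinant of the pair of plane vectors `u`, `v`. -/
def planeDet (u v : Fin 2 → ℝ) : ℝ := u 0 * v 1 - u 1 * v 0

section Seminorm

variable {E : Type*} [AddCommGroup E] [Module ℝ E] (N : Seminorm ℝ E)

lemma Seminorm.abs_le_map_smul_add_smul {u v : E} (hv : N v = 1)
    (hadd : 1 ≤ N (u + v)) (hsub : 1 ≤ N (u - v)) {a b : ℝ} (hab : |b| ≤ |a|) :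
    |b| ≤ N (a • u + b • v) := by
  rcases le_total 0 (a * b) with h | h
  · have h1 : a • (u + v) = (a • u + b • v) + (a - b) • v := by module
    have h2 := map_add_le_add N (a • u + b • v) ((a - b) • v)
    rw [← h1, map_smul_eq_mul, map_smul_eq_mul, hv, Real.norm_eq_abs, Real.norm_eq_abs] at h2
    have h3 : |a - b| = |a| - |b| := by
      grind [mul_nonneg_iff, abs_of_nonneg, abs_of_nonpos]
    nlinarith [abs_nonneg a]
  · have h1 : a • (u - v) = (a • u + b • v) + (-(a + b)) • v := by module
    have h2 := map_add_le_add N (a • u + b • v) ((-(a + b)) • v)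
    rw [← h1, map_smul_eq_mul, map_smul_eq_mul, hv, Real.norm_eq_abs, Real.norm_eq_abs,
      abs_neg] at h2
    have h3 : |a + b| = |a| - |b| := by
      grind [mul_nonpos_iff, abs_of_nonneg, abs_of_nonpos]
    nlinarith [abs_nonneg a]

lemma Seminorm.one_le_map_intCast_smul_add_of_abs_le {u v : E} (hu : N u = 1) (hv : N v = 1)
    (hadd : 1 ≤ N (u + v)) (hsub : 1 ≤ N (u - v)) {a b : ℤ} (hab : |b| ≤ |a|) (ha : a ≠ 0) :
    1 ≤ N ((a : ℝ) • u + (b : ℝ) • v) := by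
  by_cases hb : b = 0
  · subst hb
    simpa [map_smul_eq_mul, hu] using (by exact_mod_cast Int.one_le_abs ha : (1 : ℝ) ≤ |(a : ℝ)|)
  · have h1 : (1 : ℝ) ≤ |(b : ℝ)| := by exact_mod_cast Int.one_le_abs hb
    exact h1.trans (N.abs_le_map_smul_add_smul hv hadd hsub (by exact_mod_cast hab))

/-- If `u`, `v` are unit vectors and `u + v`, `u - v` have seminorm at least one, then so does every
nontrivial integral combination of `u` and `v`. -/
lemma Seminorm.one_le_map_intCast_smul_add {u v : E} (hu : N u = 1) (hv : N v = 1)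
    (hadd : 1 ≤ N (u + v)) (hsub : 1 ≤ N (u - v)) {a b : ℤ} (hab : ¬ (a = 0 ∧ b = 0)) :
    1 ≤ N ((a : ℝ) • u + (b : ℝ) • v) := by
  rcases le_total |b| |a| with h | h
  · refine N.one_le_map_intCast_smul_add_of_abs_le hu hv hadd hsub h fun ha => hab ⟨ha, ?_⟩
    simpa [ha] using h
  · rw [add_comm]
    refine N.one_le_map_intCast_smul_add_of_abs_le hv hu (by rwa [add_comm])
      (by rwa [map_sub_rev]) h fun hb => hab ⟨?_, hb⟩
    simpa [hb] using h

/-- Rescaling `u` and `v` to unit vectors keeps `v + u` outside the open unit ball, provided that `v`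
is no longer than `v + u` and no shorter than `u`. -/
lemma Seminorm.one_le_map_inv_smul_add_inv_smul {u v : E} (hu : 0 < N u) (huv : N u ≤ N v)
    (h : N v ≤ N (v + u)) : 1 ≤ N ((N v)⁻¹ • v + (N u)⁻¹ • u) := by
  have hv : 0 < N v := hu.trans_le huv
  have h1 : v + u = N u • ((N v)⁻¹ • v + (N u)⁻¹ • u) + (1 - N u / N v) • v := by
    rw [smul_add, smul_smul, smul_smul, mul_inv_cancel₀ hu.ne', div_eq_mul_inv]
    module
  have h2 := map_add_le_add N (N u • ((N v)⁻¹ • v + (N u)⁻¹ • u)) ((1 - N u / N v) • v)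
  have h3 : 0 ≤ 1 - N u / N v := by
    rw [sub_nonneg, div_le_one hv]
    exact huv
  rw [← h1, map_smul_eq_mul, map_smul_eq_mul, Real.norm_of_nonneg hu.le,
    Real.norm_of_nonneg h3] at h2
  have h4 : (1 - N u / N v) * N v = N v - N u := by field_simp
  rw [h4] at h2
  nlinarith

lemma Seminorm.map_inv_smul_self {u : E} (hu : N u ≠ 0) : N ((N u)⁻¹ • u) = 1 := by
  rw [map_smul_eq_mul, norm_inv, Real.norm_of_nonneg (apply_nonneg N u), inv_mul_cancel₀ hu]

end Seminorm

lemma planeDet_smul_smul (a b : ℝ) (u v : Fin 2 → ℝ) :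
    planeDet (a • u) (b • v) = a * b * planeDet u v := by
  simp only [planeDet, Pi.smul_apply, smul_eq_mul]
  ring

lemma planeDet_combination (a b c d : ℝ) (u v : Fin 2 → ℝ) :
    planeDet (a • u + b • v) (c • u + d • v) = (a * d - b * c) * planeDet u v := by
  simp only [planeDet, Pi.add_apply, Pi.smul_apply, smul_eq_mul]
  ring

lemma abs_planeDet_le (u v : Fin 2 → ℝ) : |planeDet u v| ≤ 2 * ‖u‖ * ‖v‖ := by
  have h : ∀ i j, |u i * v j| ≤ ‖u‖ * ‖v‖ := fun i j => by
    rw [abs_mul]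
    exact mul_le_mul (norm_le_pi_norm u i) (norm_le_pi_norm v j) (abs_nonneg _) (norm_nonneg _)
  have h1 := abs_sub (u 0 * v 1) (u 1 * v 0)
  unfold planeDet
  linarith [h 0 1, h 1 0]

lemma genLattice_subset {u v u' v' : Fin 2 → ℝ} (hu : u ∈ genLattice u' v')
    (hv : v ∈ genLattice u' v') : genLattice u v ⊆ genLattice u' v' := by
  obtain ⟨a, b, rfl⟩ := hu
  obtain ⟨c, d, rfl⟩ := hv
  rintro w ⟨m, n, rfl⟩
  refine ⟨m * a + n * c, m * b + n * d, ?_⟩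
  push_cast
  module

lemma genLattice_combination {a b c d : ℤ} (h : a * d - b * c = 1) (u v : Fin 2 → ℝ) :
    genLattice ((a : ℝ) • u + (b : ℝ) • v) ((c : ℝ) • u + (d : ℝ) • v) = genLattice u v := by
  have h' : (a : ℝ) * d - b * c = 1 := by exact_mod_cast h
  refine (genLattice_subset ⟨a, b, rfl⟩ ⟨c, d, rfl⟩).antisymm
    (genLattice_subset ⟨d, -b, ?_⟩ ⟨-c, a, ?_⟩)
  · push_cast
    linear_combination (norm := module) (-h') • u
  · push_cast
    linear_combination (norm := module) (-h') • v

lemma latticePts_eq_genLattice (g : Matrix (Fin 2) (Fin 2) ℝ) :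
    latticePts g = genLattice (fun i => g i 0) (fun i => g i 1) := by
  have h : ∀ m : Fin 2 → ℤ, (g.mulVec fun i => (m i : ℝ)) =
      (m 0 : ℝ) • (fun i => g i 0) + (m 1 : ℝ) • (fun i => g i 1) := fun m => by
    ext i
    simp [Matrix.mulVec, dotProduct, Fin.sum_univ_two, mul_comm]
  ext w
  constructor
  · rintro ⟨m, rfl⟩
    exact ⟨m 0, m 1, h m⟩
  · rintro ⟨a, b, rfl⟩
    exact ⟨![a, b], by simp [h]⟩

lemma det_eq_planeDet (g : Matrix (Fin 2) (Fin 2) ℝ) :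
    g.det = planeDet (fun i => g i 0) (fun i => g i 1) := by
  rw [Matrix.det_fin_two, planeDet]
  ring

lemma criticalDet_le {B : Set (Fin 2 → ℝ)} {u v : Fin 2 → ℝ} (hdet : planeDet u v ≠ 0)
    (hadm : ∀ w ∈ genLattice u v, w ∈ B → w = 0) : criticalDet B ≤ |planeDet u v| := by
  refine csInf_le ⟨0, ?_⟩ ⟨!![u 0, v 0; u 1, v 1], ?_⟩
  · rintro x ⟨g, -, -, rfl⟩
    exact abs_nonneg _
  · have hu : (fun i => !![u 0, v 0; u 1, v 1] i 0) = u := by ext i; fin_cases i <;> rfl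
    have hv : (fun i => !![u 0, v 0; u 1, v 1] i 1) = v := by ext i; fin_cases i <;> rfl
    rw [det_eq_planeDet, hu, hv, IsAdmissible, latticePts_eq_genLattice, hu, hv]
    exact ⟨hdet, hadm, rfl⟩

lemma eq_zero_of_mem_genLattice {N : Seminorm ℝ (Fin 2 → ℝ)} {u v w : Fin 2 → ℝ}
    (hu : N u = 1) (hv : N v = 1) (hadd : 1 ≤ N (u + v)) (hsub : 1 ≤ N (u - v))
    (hw : w ∈ genLattice u v) (hlt : N w < 1) : w = 0 := by
  obtain ⟨a, b, rfl⟩ := hw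
  by_contra hne
  refine hlt.not_ge (N.one_le_map_intCast_smul_add hu hv hadd hsub ?_)
  rintro ⟨rfl, rfl⟩
  simp at hne

section Minimum

variable {N : Seminorm ℝ (Fin 2 → ℝ)} {K : ℝ} {c d : Fin 2 → ℝ}

lemma exists_abs_le_mul_map_of_planeDet_ne_zero (hK : ∀ x, ‖x‖ ≤ K * N x)
    (hcd : planeDet c d ≠ 0) :
    ∃ R : ℝ, ∀ a b : ℝ, |a| ≤ R * N (a • c + b • d) ∧ |b| ≤ R * N (a • c + b • d) := by
  have hpos : 0 < |planeDet c d| := abs_pos.mpr hcd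
  refine ⟨2 * (‖c‖ + ‖d‖) * K / |planeDet c d|, fun a b => ?_⟩
  have hw := hK (a • c + b • d)
  have hrw : 2 * (‖c‖ + ‖d‖) * K / |planeDet c d| * N (a • c + b • d) =
      2 * (‖c‖ + ‖d‖) * (K * N (a • c + b • d)) / |planeDet c d| := by ring
  rw [hrw, le_div_iff₀ hpos, le_div_iff₀ hpos, ← abs_mul, ← abs_mul]
  have ha : planeDet (a • c + b • d) d = a * planeDet c d := by
    simpa using planeDet_combination a b 0 1 c d
  have hb : planeDet c (a • c + b • d) = b * planeDet c d := by
    simpa using planeDet_combination 1 0 a b c d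
  rw [← ha, ← hb]
  constructor
  · refine (abs_planeDet_le _ _).trans ?_
    nlinarith [norm_nonneg c, norm_nonneg d, norm_nonneg (a • c + b • d)]
  · refine (abs_planeDet_le _ _).trans ?_
    nlinarith [norm_nonneg c, norm_nonneg d, norm_nonneg (a • c + b • d)]

lemma exists_min_intCast_smul_add (hK : ∀ x, ‖x‖ ≤ K * N x) (hcd : planeDet c d ≠ 0)
    {S : Set (ℤ × ℤ)} (hS : S.Nonempty) :
    ∃ m ∈ S, ∀ n ∈ S,
      N ((m.1 : ℝ) • c + (m.2 : ℝ) • d) ≤ N ((n.1 : ℝ) • c + (n.2 : ℝ) • d) := by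
  obtain ⟨R, hR⟩ := exists_abs_le_mul_map_of_planeDet_ne_zero hK hcd
  obtain ⟨s, hs⟩ := hS
  set h : ℤ × ℤ → ℝ := fun m => N ((m.1 : ℝ) • c + (m.2 : ℝ) • d)
  have hfin : (S ∩ {m | h m ≤ h s}).Finite := by
    have hRnn : 0 ≤ |R| := abs_nonneg R
    refine ((Set.finite_Icc (-⌈|R| * h s⌉) ⌈|R| * h s⌉).prod
      (Set.finite_Icc (-⌈|R| * h s⌉) ⌈|R| * h s⌉)).subset ?_
    rintro m ⟨-, hm⟩
    have key : R * h m ≤ |R| * h s :=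
      (mul_le_mul_of_nonneg_right (le_abs_self R) (apply_nonneg N _)).trans
        (mul_le_mul_of_nonneg_left hm hRnn)
    have hbound : ∀ k : ℤ, |(k : ℝ)| ≤ R * h m → k ∈ Set.Icc (-⌈|R| * h s⌉) ⌈|R| * h s⌉ := by
      intro k hk
      have h1 : ((|k| : ℤ) : ℝ) ≤ ⌈|R| * h s⌉ := by
        push_cast
        exact (hk.trans key).trans (Int.le_ceil _)
      exact abs_le.mp (by exact_mod_cast h1)
    exact ⟨hbound _ (hR _ _).1, hbound _ (hR _ _).2⟩
  obtain ⟨m, ⟨hmS, hms⟩, hmin⟩ := Set.exists_min_image _ h hfin ⟨s, hs, le_refl (h s)⟩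
  refine ⟨m, hmS, fun n hn => ?_⟩
  rcases le_total (h n) (h s) with hle | hle
  · exact hmin n ⟨hn, hle⟩
  · exact le_trans hms hle

/-- Every plane lattice has a basis `u`, `v` which is reduced with respect to the norm `N`. -/
lemma exists_reduced_basis (hK : ∀ x, ‖x‖ ≤ K * N x) (hcd : planeDet c d ≠ 0) :
    ∃ u v, genLattice u v = genLattice c d ∧ planeDet u v = planeDet c d ∧ 0 < N u ∧
      N u ≤ N v ∧ N v ≤ N (v + u) ∧ N v ≤ N (v - u) := by
  obtain ⟨⟨a, b⟩, hab, hmin⟩ := exists_min_intCast_smul_add hK hcd (S := {m | m ≠ 0})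
    ⟨(1, 0), by simp⟩
  simp only [Set.mem_ofPred_eq, ne_eq, Prod.mk_eq_zero, Prod.forall] at hab hmin
  obtain ⟨R, hR⟩ := exists_abs_le_mul_map_of_planeDet_ne_zero hK hcd
  have hupos : 0 < N ((a : ℝ) • c + (b : ℝ) • d) := by
    refine (apply_nonneg N _).lt_of_ne' fun h0 => hab ?_
    have := hR a b
    rw [h0, mul_zero] at this
    simpa using this
  have hgcd : Int.gcd a b = 1 := by
    obtain ⟨a', ha'⟩ := Int.gcd_dvd_left (a := a) (b := b)
    obtain ⟨b', hb'⟩ := Int.gcd_dvd_right (a := a) (b := b)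
    have hg0 : Int.gcd a b ≠ 0 := by
      rwa [Ne, Int.gcd_eq_zero_iff]
    set k := Int.gcd a b
    have hne : ¬ (a' = 0 ∧ b' = 0) := by
      rintro ⟨rfl, rfl⟩
      exact hab ⟨by simpa using ha', by simpa using hb'⟩
    have h1 := hmin a' b' hne
    have h2 : (a : ℝ) • c + (b : ℝ) • d = (k : ℝ) • ((a' : ℝ) • c + (b' : ℝ) • d) := by
      have ha'' : (a : ℝ) = k * a' := by exact_mod_cast ha'
      have hb'' : (b : ℝ) = k * b' := by exact_mod_cast hb'
      rw [ha'', hb'']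
      module
    have h3 : N ((a : ℝ) • c + (b : ℝ) • d) = k * N ((a' : ℝ) • c + (b' : ℝ) • d) := by
      rw [h2, map_smul_eq_mul, Real.norm_of_nonneg (Nat.cast_nonneg k)]
    by_contra hk1
    have h4 : (2 : ℝ) ≤ k := by exact_mod_cast (by omega : 2 ≤ k)
    nlinarith
  have hbez : a * Int.gcdA a b + b * Int.gcdB a b = 1 := by
    rw [← Int.gcd_eq_gcd_ab, hgcd]
    rfl
  set x := Int.gcdA a b
  set y := Int.gcdB a b
  have hunim : ∀ k : ℤ, a * (x + k * b) - b * (-y + k * a) = 1 := fun k => by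
    linear_combination hbez
  obtain ⟨-, ⟨k, rfl⟩, hv⟩ := exists_min_intCast_smul_add hK hcd
    (S := Set.range fun k : ℤ => (-y + k * a, x + k * b)) (Set.range_nonempty _)
  simp only [Set.forall_mem_range] at hv
  refine ⟨(a : ℝ) • c + (b : ℝ) • d,
    ((-y + k * a : ℤ) : ℝ) • c + ((x + k * b : ℤ) : ℝ) • d,
    genLattice_combination (hunim k) c d, ?_, hupos, hmin _ _ ?_, ?_, ?_⟩
  · have h1 : (a : ℝ) * ((x + k * b : ℤ) : ℝ) - b * ((-y + k * a : ℤ) : ℝ) = 1 := by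
      exact_mod_cast hunim k
    rw [planeDet_combination, h1, one_mul]
  · rintro ⟨h1, h2⟩
    have := hunim k
    simp [h1, h2] at this
  · convert hv (k + 1) using 2
    push_cast
    module
  · convert hv (k - 1) using 2
    push_cast
    module

end Minimum

/-- If no lattice with a basis close to `u`, `v` consisting of unit vectors has smaller covolume, then
`u + v` or `u - v` is a unit vector. -/
lemma map_add_eq_one_or_map_sub_eq_one {N : Seminorm ℝ (Fin 2 → ℝ)} (hN : Continuous N)
    {u v : Fin 2 → ℝ} (hdet : planeDet u v ≠ 0) (hu : N u = 1) (hv : N v = 1)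
    (hadd : 1 ≤ N (u + v)) (hsub : 1 ≤ N (u - v))
    (hcrit : ∀ x y, planeDet x y ≠ 0 → N x = 1 → N y = 1 → 1 ≤ N (x + y) → 1 ≤ N (x - y) →
      |planeDet u v| ≤ |planeDet x y|) :
    N (u + v) = 1 ∨ N (u - v) = 1 := by
  by_contra! hcon
  have hadd' := lt_of_le_of_ne' hadd hcon.1
  have hsub' := lt_of_le_of_ne' hsub hcon.2
  set f : ℝ × ℝ → Fin 2 → ℝ := fun z => (N (u + z.1 • v))⁻¹ • (u + z.1 • v) with hf
  set g : ℝ × ℝ → Fin 2 → ℝ := fun z => (N (v + z.2 • u))⁻¹ • (v + z.2 • u) with hg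
  have hx : ContinuousAt (fun z : ℝ × ℝ => N (u + z.1 • v)) 0 := by fun_prop
  have hy : ContinuousAt (fun z : ℝ × ℝ => N (v + z.2 • u)) 0 := by fun_prop
  have hfc : ContinuousAt f 0 := by
    refine ContinuousAt.smul (hx.inv₀ (by simp [hu])) (by fun_prop)
  have hgc : ContinuousAt g 0 := by
    refine ContinuousAt.smul (hy.inv₀ (by simp [hv])) (by fun_prop)
  have hev : ∀ᶠ z in nhds (0 : ℝ × ℝ), 1 < N (f z + g z) ∧ 1 < N (f z - g z) ∧
      0 < N (u + z.1 • v) ∧ 0 < N (v + z.2 • u) := by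
    have e1 : ContinuousAt (fun z => N (f z + g z)) 0 := hN.continuousAt.comp (hfc.add hgc)
    have e2 : ContinuousAt (fun z => N (f z - g z)) 0 := hN.continuousAt.comp (hfc.sub hgc)
    refine (e1.eventually_const_lt ?_).and ((e2.eventually_const_lt ?_).and
      ((hx.eventually_const_lt ?_).and (hy.eventually_const_lt ?_)))
    · simpa [hf, hg, hu, hv] using hadd'
    · simpa [hf, hg, hu, hv] using hsub'
    · simp [hu]
    · simp [hv]
  obtain ⟨ε, hε, hball⟩ := Metric.eventually_nhds_iff.mp hev
  have key : ∀ s t : ℝ, |s| < ε → |t| < ε → s * t < 1 →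
      N (u + s • v) * N (v + t • u) ≤ 1 - s * t := by
    intro s t hs ht hst
    obtain ⟨h1, h2, h3, h4⟩ := hball (y := (s, t)) (by
      rw [dist_zero_right, Prod.norm_def]
      exact max_lt hs ht)
    simp only [] at h3 h4
    have hd : planeDet (f (s, t)) (g (s, t)) =
        (N (u + s • v))⁻¹ * (N (v + t • u))⁻¹ * ((1 - s * t) * planeDet u v) := by
      rw [hf, hg, planeDet_smul_smul]
      congr 1
      simpa [add_comm] using planeDet_combination 1 s t 1 u v
    have hpos : 0 < 1 - s * t := by linarith
    have h5 := hcrit (f (s, t)) (g (s, t)) (by rw [hd]; positivity)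
      (N.map_inv_smul_self h3.ne') (N.map_inv_smul_self h4.ne') h1.le h2.le
    rw [hd, abs_mul, abs_mul (1 - s * t), abs_of_pos (by positivity : 0 <
      (N (u + s • v))⁻¹ * (N (v + t • u))⁻¹), abs_of_pos hpos, ← mul_assoc,
      le_mul_iff_one_le_left (abs_pos.mpr hdet), ← mul_inv, inv_mul_eq_div,
      one_le_div (by positivity)] at h5
    exact h5
  have hle : ∀ s : ℝ, |s| < ε → N (u + s • v) ≤ 1 ∧ N (v + s • u) ≤ 1 := by
    intro s hs
    have h1 := key s 0 hs (by simpa using hε) (by simp)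
    have h2 := key 0 s (by simpa using hε) hs (by simp)
    simp only [zero_smul, add_zero, hu, hv, mul_zero, zero_mul, sub_zero, mul_one, one_mul]
      at h1 h2
    exact ⟨h1, h2⟩
  have hge : ∀ (x y : Fin 2 → ℝ) (s : ℝ), N x = 1 → N (x + (-s) • y) ≤ 1 →
      1 ≤ N (x + s • y) := by
    intro x y s hxy h
    have h1 := map_add_le_add N (x + s • y) (x + (-s) • y)
    rw [show x + s • y + (x + (-s) • y) = (2 : ℝ) • x by module, map_smul_eq_mul, hxy] at h1
    norm_num at h1
    rw [neg_smul] at h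
    linarith
  obtain ⟨s, hs0, hs⟩ := exists_between (lt_min hε one_pos)
  have hsε : |s| < ε := by
    rw [abs_of_pos hs0]
    exact hs.trans_le (min_le_left _ _)
  have hs1 : s < 1 := hs.trans_le (min_le_right _ _)
  have hneg := hle (-s) (by rwa [abs_neg])
  have h1 := hge u v s hu hneg.1
  have h2 := hge v u s hv hneg.2
  have h3 := key s s hsε hsε (by nlinarith)
  nlinarith

/-- A lattice of minimal covolume among those with a basis of unit vectors `x`, `y` for which `x + y`
and `x - y` have norm at least one itself has such a basis, with `x + y` or `x - y` a unit vector. -/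
lemma exists_unit_basis {N : Seminorm ℝ (Fin 2 → ℝ)} (hN : Continuous N) {K : ℝ}
    (hK : ∀ x, ‖x‖ ≤ K * N x) {c d : Fin 2 → ℝ} (hcd : planeDet c d ≠ 0)
    (hadm : ∀ w ∈ genLattice c d, N w ≠ 0 → 1 ≤ N w)
    (hcrit : ∀ x y, planeDet x y ≠ 0 → N x = 1 → N y = 1 → 1 ≤ N (x + y) → 1 ≤ N (x - y) →
      |planeDet c d| ≤ |planeDet x y|) :
    ∃ u v, genLattice u v = genLattice c d ∧ N u = 1 ∧ N v = 1 ∧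
      (N (u + v) = 1 ∨ N (u - v) = 1) := by
  obtain ⟨u, v, hgen, hdet, hu, huv, hadd, hsub⟩ := exists_reduced_basis hK hcd
  rw [← hdet] at hcd hcrit
  have hv : 0 < N v := hu.trans_le huv
  have hu1 : 1 ≤ N u := hadm u (hgen ▸ ⟨1, 0, by simp⟩) hu.ne'
  have hadd' := N.one_le_map_inv_smul_add_inv_smul hu huv hadd
  have hsub' := N.one_le_map_inv_smul_add_inv_smul (u := -u) (v := v)
    (by rwa [map_neg_eq_map]) (by rwa [map_neg_eq_map]) (by rwa [← sub_eq_add_neg])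
  rw [map_neg_eq_map, smul_neg, ← sub_eq_add_neg, map_sub_rev] at hsub'
  rw [add_comm] at hadd'
  have h1 := hcrit ((N u)⁻¹ • u) ((N v)⁻¹ • v) (by rw [planeDet_smul_smul]; positivity)
    (N.map_inv_smul_self hu.ne') (N.map_inv_smul_self hv.ne') hadd' hsub'
  rw [planeDet_smul_smul, abs_mul, le_mul_iff_one_le_left (abs_pos.mpr hcd),
    abs_of_pos (by positivity), ← mul_inv, one_le_inv₀ (by positivity)] at h1
  have hu' : N u = 1 := by nlinarith
  have hv' : N v = 1 := by nlinarith
  refine ⟨u, v, hgen, hu', hv', map_add_eq_one_or_map_sub_eq_one hN hcd hu' hv' ?_ ?_ hcrit⟩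
  · simpa [hu', hv'] using hadd'
  · simpa [hu', hv'] using hsub'

/-- A bounded symmetric convex neighbourhood of zero in the plane is the open unit ball of a norm. -/
lemma exists_seminorm_of_isOpen_convex {B : Set (Fin 2 → ℝ)}
    (hopen : IsOpen B) (hbdd : Bornology.IsBounded B) (hconv : Convex ℝ B)
    (hsymm : ∀ v ∈ B, -v ∈ B) (hne : B.Nonempty) :
    ∃ N : Seminorm ℝ (Fin 2 → ℝ), Continuous N ∧ (∃ K : ℝ, ∀ x, ‖x‖ ≤ K * N x) ∧
      (∀ x, x ∈ B ↔ N x < 1) ∧ ∀ x, x ∈ frontier B ↔ N x = 1 := by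
  have h0 : (0 : Fin 2 → ℝ) ∈ B := by
    obtain ⟨x, hx⟩ := hne
    simpa using hconv hx (hsymm x hx) (by norm_num : (0 : ℝ) ≤ 1 / 2)
      (by norm_num : (0 : ℝ) ≤ 1 / 2) (by norm_num)
  have hnhds : B ∈ nhds (0 : Fin 2 → ℝ) := hopen.mem_nhds h0
  have habs : Absorbent ℝ B := absorbent_nhds_zero hnhds
  have hbal : Balanced ℝ B := by
    rw [balanced_iff_smul_mem]
    intro a ha x hx
    rw [Real.norm_eq_abs] at ha
    rcases le_total 0 a with h | h
    · exact hconv.smul_mem_of_zero_mem h0 hx ⟨h, (le_abs_self a).trans ha⟩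
    · have := hconv.smul_mem_of_zero_mem h0 (hsymm x hx)
        ⟨neg_nonneg.mpr h, (neg_le_abs a).trans ha⟩
      simpa using this
  obtain ⟨r, hr, hB⟩ := hbdd.subset_closedBall_lt 0 0
  refine ⟨gaugeSeminorm hbal hconv habs, continuous_gauge hconv hnhds, ⟨r, fun x => ?_⟩,
    fun x => ?_, fun x => ?_⟩
  · have h := le_gauge_of_subset_closedBall habs hr.le hB (x := x)
    rwa [div_le_iff₀' hr] at h
  · have h := setOfPred_gauge_lt_one_eq_self_of_isOpen hconv h0 hopen
    exact (Set.ext_iff.mp h x).symm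
  · exact (gauge_eq_one_iff_mem_frontier hconv hnhds).symm

/-- Three pairs of lattice points on the boundary of a critical lattice, and the converse
(Mahler; cf. Cassels V.8.3). -/
theorem critical_lattice_three_pairs (B : Set (Fin 2 → ℝ))
    (hopen : IsOpen B) (hbdd : Bornology.IsBounded B) (hconv : Convex ℝ B)
    (hsymm : ∀ v ∈ B, -v ∈ B) (hne : B.Nonempty) :
    (∀ g : Matrix (Fin 2) (Fin 2) ℝ, g.det ≠ 0 → IsAdmissible B g →
      |g.det| = criticalDet B →
      ∃ p q r : Fin 2 → ℝ,
        p ∈ latticePts g ∧ q ∈ latticePts g ∧ r ∈ latticePts g ∧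
        p ∈ frontier B ∧ q ∈ frontier B ∧ r ∈ frontier B ∧
        p = q - r ∧
        genLattice p q = latticePts g ∧ genLattice q r = latticePts g ∧
        genLattice p r = latticePts g) ∧
    (∀ p q r : Fin 2 → ℝ,
      p ∈ frontier B → q ∈ frontier B → r ∈ frontier B → p = q - r →
      ∀ w ∈ genLattice p q, w ∈ B → w = 0) := by
  obtain ⟨N, hN, ⟨K, hK⟩, hB, hfr⟩ :=
    exists_seminorm_of_isOpen_convex hopen hbdd hconv hsymm hne
  simp only [hfr]
  constructor
  · intro g hg hadm hcritical
    rw [IsAdmissible, latticePts_eq_genLattice] at hadm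
    rw [det_eq_planeDet] at hg hcritical
    rw [latticePts_eq_genLattice]
    obtain ⟨u, v, hgen, hu, hv, huv⟩ := exists_unit_basis hN hK hg
      (fun w hw hw0 => not_lt.mp fun hlt => hw0 (by rw [hadm w hw ((hB w).mpr hlt), map_zero]))
      (fun x y hxy hx hy hadd hsub => hcritical.le.trans (criticalDet_le hxy fun w hw hwB =>
        eq_zero_of_mem_genLattice hx hy hadd hsub hw ((hB w).mp hwB)))
    rw [← hgen]
    rcases huv with h | h
    · refine ⟨u + v, u, -v, ⟨1, 1, by simp⟩, ⟨1, 0, by simp⟩, ⟨0, -1, by simp⟩, h, hu,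
        by rwa [map_neg_eq_map], by simp, ?_, ?_, ?_⟩
      · exact (genLattice_subset ⟨1, 1, by simp⟩ ⟨1, 0, by simp⟩).antisymm
          (genLattice_subset ⟨0, 1, by simp⟩ ⟨1, -1, by simp⟩)
      · exact (genLattice_subset ⟨1, 0, by simp⟩ ⟨0, -1, by simp⟩).antisymm
          (genLattice_subset ⟨1, 0, by simp⟩ ⟨0, -1, by simp⟩)
      · exact (genLattice_subset ⟨1, 1, by simp⟩ ⟨0, -1, by simp⟩).antisymm
          (genLattice_subset ⟨1, 1, by simp⟩ ⟨0, -1, by simp⟩)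
    · refine ⟨u - v, u, v, ⟨1, -1, by simp [sub_eq_add_neg]⟩, ⟨1, 0, by simp⟩,
        ⟨0, 1, by simp⟩, h, hu, hv, rfl, ?_, rfl, ?_⟩
      · exact (genLattice_subset ⟨1, -1, by simp [sub_eq_add_neg]⟩ ⟨1, 0, by simp⟩).antisymm
          (genLattice_subset ⟨0, 1, by simp⟩ ⟨-1, 1, by simp⟩)
      · exact (genLattice_subset ⟨1, -1, by simp [sub_eq_add_neg]⟩ ⟨0, 1, by simp⟩).antisymm
          (genLattice_subset ⟨1, 1, by simp⟩ ⟨0, 1, by simp⟩)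
  · intro p q r hp hq hr hpqr w hw hwB
    have hsub : N (p - q) = 1 := by
      rw [hpqr, sub_sub_cancel_left, map_neg_eq_map, hr]
    have hadd : 1 ≤ N (p + q) := by
      have h := map_add_le_add N (p + q) (p - q)
      rw [show p + q + (p - q) = (2 : ℝ) • p by module, map_smul_eq_mul, hp, hsub] at h
      norm_num at h
      linarith
    exact eq_zero_of_mem_genLattice hp hq hadd hsub.ge hw ((hB w).mp hwB)
end

section
/- The set of matrices in SL_{m+n}(ℝ) that can be written as a product [[I_m, 0],[C, I_n]]·[[B, 0],[0, D]]·[[I_m, A],[0, I_n]], with A ∈ M_{m,n}(ℝ), C ∈ M_{n,m}(ℝ), B ∈ M_{m,m}(ℝ), D ∈ M_{n,n}(ℝ) and det(B)·det(D) = 1, is open, dense, and of full Haar measure in SL_{m+n}(ℝ). -/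
open Matrix MeasureTheory

noncomputable instance SLtop (m n : ℕ) :
    TopologicalSpace (Matrix.SpecialLinearGroup (Fin m ⊕ Fin n) ℝ) := by
  unfold Matrix.SpecialLinearGroup; infer_instance

noncomputable instance SLmeas (m n : ℕ) :
    MeasurableSpace (Matrix.SpecialLinearGroup (Fin m ⊕ Fin n) ℝ) := borel _

/-- the "big cell": products of a lower unipotent, a block diagonal, and an upper
unipotent block matrix -/
def bigCell (m n : ℕ) : Set (Matrix.SpecialLinearGroup (Fin m ⊕ Fin n) ℝ) :=
  {g | ∃ (A : Matrix (Fin m) (Fin n) ℝ) (C : Matrix (Fin n) (Fin m) ℝ)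
        (B : Matrix (Fin m) (Fin m) ℝ) (D : Matrix (Fin n) (Fin n) ℝ),
      B.det * D.det = 1 ∧
      (g : Matrix (Fin m ⊕ Fin n) (Fin m ⊕ Fin n) ℝ) =
        Matrix.fromBlocks 1 0 C 1 * Matrix.fromBlocks B 0 0 D *
          Matrix.fromBlocks 1 A 0 1}

/-- A matrix of determinant one lies in the big cell iff its upper left block is invertible. -/
theorem mem_bigCell_iff {m n : ℕ} (g : Matrix.SpecialLinearGroup (Fin m ⊕ Fin n) ℝ) :
    g ∈ bigCell m n ↔ (g.1.toBlocks₁₁).det ≠ 0 := by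
  constructor
  · rintro ⟨A, C, B, D, h, hg⟩
    have hB : g.1.toBlocks₁₁ = B := by
      rw [hg]
      simp [Matrix.fromBlocks_multiply]
    rw [hB]
    exact left_ne_zero_of_mul_eq_one h
  · intro h
    have := Matrix.invertibleOfIsUnitDet _ (isUnit_iff_ne_zero.mpr h)
    have hg : g.1 = _ := (Matrix.fromBlocks_toBlocks g.1).symm.trans
      (Matrix.fromBlocks_eq_of_invertible₁₁ _ _ _ _)
    refine ⟨_, _, _, _, ?_, hg⟩
    have hdet := congrArg Matrix.det hg
    rw [g.2, Matrix.det_mul, Matrix.det_mul] at hdet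
    simpa using hdet.symm

theorem continuous_specialLinearGroup_val (m n : ℕ) :
    Continuous (fun g : Matrix.SpecialLinearGroup (Fin m ⊕ Fin n) ℝ => g.1) :=
  continuous_subtype_val

/-- If `a` and `c` have no common kernel, then `a + T c` is invertible for some `T`. -/
theorem Matrix.exists_det_add_mul_ne_zero {K ι κ : Type*} [Field K] [Fintype ι] [DecidableEq ι]
    [Fintype κ] [DecidableEq κ] (a : Matrix ι ι K) (c : Matrix κ ι K)
    (h : ∀ v, a *ᵥ v = 0 → c *ᵥ v = 0 → v = 0) :
    ∃ T : Matrix ι κ K, (a + T * c).det ≠ 0 := by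
  obtain ⟨W, hW⟩ := Submodule.exists_isCompl (LinearMap.range (Matrix.toLin' a))
  have hdim : Module.finrank K (LinearMap.ker (Matrix.toLin' a)) = Module.finrank K W := by
    have h₁ := LinearMap.finrank_range_add_finrank_ker (Matrix.toLin' a)
    have h₂ := Submodule.finrank_add_eq_of_isCompl hW
    omega
  let e := LinearEquiv.ofFinrankEq _ _ hdim
  obtain ⟨L, hL⟩ := LinearMap.exists_leftInverse_of_injective
    ((Matrix.toLin' c).comp (LinearMap.ker (Matrix.toLin' a)).subtype) (by
      rw [LinearMap.ker_eq_bot']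
      rintro ⟨v, hv⟩ hcv
      exact Subtype.ext (h v (by simpa using hv) (by simpa using hcv)))
  let F := W.subtype ∘ₗ e.toLinearMap ∘ₗ L
  refine ⟨LinearMap.toMatrix' F, fun hdet => ?_⟩
  obtain ⟨v, hv0, hv⟩ := Matrix.exists_mulVec_eq_zero_iff.mpr hdet
  rw [Matrix.add_mulVec, ← Matrix.mulVec_mulVec, LinearMap.toMatrix'_mulVec] at hv
  have hFW : F (c *ᵥ v) ∈ W := (e (L (c *ᵥ v))).2
  have hav : a *ᵥ v = 0 := by
    refine (Submodule.disjoint_def.mp hW.disjoint) _ ⟨v, by simp⟩ ?_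
    rw [eq_neg_of_add_eq_zero_left hv]
    exact W.neg_mem hFW
  have hLv : L (c *ᵥ v) = ⟨v, by simpa using hav⟩ := by
    simpa using LinearMap.congr_fun hL ⟨v, by simpa using hav⟩
  rw [hav, zero_add] at hv
  have hev : L (c *ᵥ v) = 0 := by
    simpa [F] using hv
  rw [hLv] at hev
  exact hv0 (congrArg Subtype.val hev)

/-- The upper unipotent element with off-diagonal block `T`. -/
def upperUnipotent {m n : ℕ} (T : Matrix (Fin m) (Fin n) ℝ) :
    Matrix.SpecialLinearGroup (Fin m ⊕ Fin n) ℝ :=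
  ⟨Matrix.fromBlocks 1 T 0 1, by simp⟩

theorem continuous_upperUnipotent (m n : ℕ) :
    Continuous (upperUnipotent : Matrix (Fin m) (Fin n) ℝ → _) :=
  Continuous.subtype_mk
    (continuous_const.matrix_fromBlocks continuous_id continuous_const continuous_const) _

theorem upperUnipotent_zero (m n : ℕ) : upperUnipotent (0 : Matrix (Fin m) (Fin n) ℝ) = 1 :=
  Subtype.ext Matrix.fromBlocks_one

theorem toBlocks₁₁_upperUnipotent_mul {m n : ℕ} (T : Matrix (Fin m) (Fin n) ℝ)
    (g : Matrix.SpecialLinearGroup (Fin m ⊕ Fin n) ℝ) :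
    (upperUnipotent T * g).1.toBlocks₁₁ = g.1.toBlocks₁₁ + T * g.1.toBlocks₂₁ := by
  change (Matrix.fromBlocks 1 T 0 1 * g.1).toBlocks₁₁ = _
  conv_lhs => rw [← Matrix.fromBlocks_toBlocks g.1, Matrix.fromBlocks_multiply]
  simp

theorem toBlocks₂₁_upperUnipotent_mul {m n : ℕ} (T : Matrix (Fin m) (Fin n) ℝ)
    (g : Matrix.SpecialLinearGroup (Fin m ⊕ Fin n) ℝ) :
    (upperUnipotent T * g).1.toBlocks₂₁ = g.1.toBlocks₂₁ := by
  change (Matrix.fromBlocks 1 T 0 1 * g.1).toBlocks₂₁ = _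
  conv_lhs => rw [← Matrix.fromBlocks_toBlocks g.1, Matrix.fromBlocks_multiply]
  simp

/-- Some upper unipotent element translates a given element into the big cell. -/
theorem exists_upperUnipotent_mul_mem_bigCell {m n : ℕ}
    (g : Matrix.SpecialLinearGroup (Fin m ⊕ Fin n) ℝ) :
    ∃ T, upperUnipotent T * g ∈ bigCell m n := by
  simp_rw [mem_bigCell_iff, toBlocks₁₁_upperUnipotent_mul]
  refine Matrix.exists_det_add_mul_ne_zero _ _ fun v ha hc => ?_
  have hg : g.1 *ᵥ Sum.elim v 0 = 0 := by
    rw [← Matrix.fromBlocks_toBlocks g.1, Matrix.fromBlocks_mulVec]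
    ext (i | i) <;> simp [ha, hc]
  have h0 := Matrix.eq_zero_of_mulVec_eq_zero (by rw [g.2]; exact one_ne_zero) hg
  exact funext fun i => congrFun h0 (Sum.inl i)

/-- A line of upper unipotent translates that meets the big cell leaves it only finitely often. -/
theorem finite_upperUnipotent_smul_mul_notMem_bigCell {m n : ℕ} (T : Matrix (Fin m) (Fin n) ℝ)
    (g : Matrix.SpecialLinearGroup (Fin m ⊕ Fin n) ℝ) {s : ℝ}
    (hs : upperUnipotent (s • T) * g ∈ bigCell m n) :
    {t : ℝ | upperUnipotent (t • T) * g ∉ bigCell m n}.Finite := by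
  let p : Polynomial ℝ := Matrix.det
    ((Polynomial.X : Polynomial ℝ) • (T * g.1.toBlocks₂₁).map Polynomial.C +
      g.1.toBlocks₁₁.map Polynomial.C)
  have hp (t : ℝ) : p.eval t = (upperUnipotent (t • T) * g).1.toBlocks₁₁.det := by
    rw [toBlocks₁₁_upperUnipotent_mul, ← Polynomial.coe_evalRingHom, RingHom.map_det]
    congr 1
    ext i j
    simp [-Matrix.map_mul, add_comm]
    exact mul_comm _ _
  have hp0 : p ≠ 0 := by
    rintro h
    rw [mem_bigCell_iff, ← hp, h] at hs
    simp at hs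
  refine (p.rootSet_finite ℝ).subset fun t ht => ?_
  simp only [Set.mem_ofPred_eq, mem_bigCell_iff, not_not, ← hp] at ht
  exact (Polynomial.mem_rootSet_of_ne hp0).mpr (by simpa using ht)

/-- A set that meets every right translate of a curve in a countable set is null for every
left-invariant measure. -/
theorem measure_eq_zero_of_countable_curve_preimage {G : Type*} [Mul G] [TopologicalSpace G]
    [ContinuousMul G] [SecondCountableTopology G] [MeasurableSpace G] [BorelSpace G]
    (μ : Measure G) [SFinite μ] (hinv : ∀ g, μ.map (fun x => g * x) = μ)
    {γ : ℝ → G} (hγ : Continuous γ) {S : Set G} (hS : MeasurableSet S)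
    (h : ∀ x, {t | γ t * x ∈ S}.Countable) : μ S = 0 := by
  have hE : MeasurableSet {p : G × ℝ | γ p.2 * p.1 ∈ S} :=
    ((hγ.comp continuous_snd).mul continuous_fst).measurable hS
  have hnull : (μ.prod volume) {p : G × ℝ | γ p.2 * p.1 ∈ S} = 0 :=
    (Measure.measure_prod_null hE).mpr (.of_forall fun x => (h x).measure_zero _)
  rw [← Measure.prod_swap, Measure.map_apply measurable_swap hE] at hnull
  obtain ⟨t, ht⟩ := (Measure.measure_ae_null_of_prod_null hnull).exists
  rw [← hinv (γ t), Measure.map_apply (continuous_const_mul (γ t)).measurable hS]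
  exact ht

theorem isOpen_bigCell (m n : ℕ) : IsOpen (bigCell m n) := by
  have h : bigCell m n = {g | (g.1.toBlocks₁₁).det ≠ 0} := Set.ext mem_bigCell_iff
  rw [h]
  refine isOpen_ne_fun (Continuous.matrix_det ?_) continuous_const
  exact (continuous_specialLinearGroup_val m n).matrix_submatrix Sum.inl Sum.inl

theorem continuousMul_specialLinearGroup (m n : ℕ) :
    ContinuousMul (Matrix.SpecialLinearGroup (Fin m ⊕ Fin n) ℝ) :=
  ⟨Continuous.subtype_mk (((continuous_specialLinearGroup_val m n).comp continuous_fst).mul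
    ((continuous_specialLinearGroup_val m n).comp continuous_snd)) _⟩

theorem dense_bigCell (m n : ℕ) : Dense (bigCell m n) := by
  have := continuousMul_specialLinearGroup m n
  intro g
  obtain ⟨T, hT⟩ := exists_upperUnipotent_mul_mem_bigCell g
  have hfin := finite_upperUnipotent_smul_mul_notMem_bigCell T g (s := 1) (by simpa using hT)
  have hcont : Continuous fun t : ℝ => upperUnipotent (t • T) * g :=
    ((continuous_upperUnipotent m n).comp (continuous_id.smul continuous_const)).mul
      continuous_const
  have hmem := map_mem_closure hcont (hfin.countable.dense_compl ℝ 0)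
    (t := bigCell m n) fun t ht => not_not.mp ht
  simpa [upperUnipotent_zero] using hmem

theorem measure_compl_bigCell (m n : ℕ)
    (μ : Measure (Matrix.SpecialLinearGroup (Fin m ⊕ Fin n) ℝ))
    (hinv : ∀ g, μ.map (fun x => g * x) = μ)
    (hfin : ∀ K : Set (Matrix.SpecialLinearGroup (Fin m ⊕ Fin n) ℝ), IsCompact K → μ K < ⊤) :
    μ (bigCell m n)ᶜ = 0 := by
  have := continuousMul_specialLinearGroup m n
  have : BorelSpace (Matrix.SpecialLinearGroup (Fin m ⊕ Fin n) ℝ) := ⟨rfl⟩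
  have : SecondCountableTopology (Matrix.SpecialLinearGroup (Fin m ⊕ Fin n) ℝ) :=
    have : SecondCountableTopology (Matrix (Fin m ⊕ Fin n) (Fin m ⊕ Fin n) ℝ) :=
      inferInstanceAs (SecondCountableTopology (Fin m ⊕ Fin n → Fin m ⊕ Fin n → ℝ))
    TopologicalSpace.Subtype.secondCountableTopology
      {A : Matrix (Fin m ⊕ Fin n) (Fin m ⊕ Fin n) ℝ | A.det = 1}
  have : LocallyCompactSpace (Matrix.SpecialLinearGroup (Fin m ⊕ Fin n) ℝ) :=
    have : LocallyCompactSpace (Matrix (Fin m ⊕ Fin n) (Fin m ⊕ Fin n) ℝ) :=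
      inferInstanceAs (LocallyCompactSpace (Fin m ⊕ Fin n → Fin m ⊕ Fin n → ℝ))
    (isClosed_eq (continuous_id.matrix_det) continuous_const :
      IsClosed {A : Matrix (Fin m ⊕ Fin n) (Fin m ⊕ Fin n) ℝ | A.det = 1}).locallyCompactSpace
  have : IsFiniteMeasureOnCompacts μ := ⟨fun {K} hK => hfin K hK⟩
  let S (T : Matrix (Fin m) (Fin n) ℝ) : Set (Matrix.SpecialLinearGroup (Fin m ⊕ Fin n) ℝ) :=
    (bigCell m n)ᶜ ∩ {g | upperUnipotent T * g ∈ bigCell m n}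
  have hS (T) : μ (S T) = 0 := by
    refine measure_eq_zero_of_countable_curve_preimage μ hinv
      (γ := fun t => upperUnipotent (t • T))
      ((continuous_upperUnipotent m n).comp (continuous_id.smul continuous_const))
      ((isOpen_bigCell m n).measurableSet.compl.inter
        ((isOpen_bigCell m n).preimage (continuous_const.mul continuous_id)).measurableSet)
      fun g => ?_
    by_cases hne : ∃ t : ℝ, upperUnipotent (t • T) * g ∈ bigCell m n
    · obtain ⟨s, hs⟩ := hne
      exact ((finite_upperUnipotent_smul_mul_notMem_bigCell T g hs).subset
        fun t ht => ht.1).countable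
    · push Not at hne
      refine Set.countable_empty.mono fun t ht => hne (1 + t) ?_
      have h2 := ht.2
      simp only [Set.mem_ofPred_eq, mem_bigCell_iff, toBlocks₁₁_upperUnipotent_mul,
        toBlocks₂₁_upperUnipotent_mul] at h2 ⊢
      convert h2 using 2
      rw [add_smul, one_smul, Matrix.add_mul]
      abel
  have : TopologicalSpace.SeparableSpace (Matrix (Fin m) (Fin n) ℝ) :=
    inferInstanceAs (TopologicalSpace.SeparableSpace (Fin m → Fin n → ℝ))
  obtain ⟨D, hDc, hD⟩ := TopologicalSpace.exists_countable_dense (Matrix (Fin m) (Fin n) ℝ)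
  refine measure_mono_null (fun g hg => ?_) ((measure_biUnion_null_iff hDc).mpr fun T _ => hS T)
  have hopen : IsOpen {T | upperUnipotent T * g ∈ bigCell m n} :=
    (isOpen_bigCell m n).preimage ((continuous_upperUnipotent m n).mul continuous_const)
  obtain ⟨T, hT, hTD⟩ := hD.inter_open_nonempty _ hopen (exists_upperUnipotent_mul_mem_bigCell g)
  exact Set.mem_biUnion hTD ⟨hg, hT⟩

/-- The big cell is open, dense, and of full Haar measure in `SL_{m+n}(ℝ)`. -/
theorem bigCell_open_dense_conull (m n : ℕ) (hm : 0 < m) (hn : 0 < n)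
    (μ : Measure (Matrix.SpecialLinearGroup (Fin m ⊕ Fin n) ℝ))
    (hμ : μ ≠ 0)
    (hinv : ∀ g, μ.map (fun x => g * x) = μ)
    (hfin : ∀ K : Set (Matrix.SpecialLinearGroup (Fin m ⊕ Fin n) ℝ),
      IsCompact K → μ K < ⊤) :
    IsOpen (bigCell m n) ∧ Dense (bigCell m n) ∧ μ (bigCell m n)ᶜ = 0 :=
  ⟨isOpen_bigCell m n, dense_bigCell m n, measure_compl_bigCell m n μ hinv hfin⟩
end
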